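/- Let d ≥ 1, α > 0, let μ and ρ be probability measures on ℝᵈ with finite first moments, let v ∈ ℝᵈ, and let ρ̄ := (τ_v)_♯ρ be the pushforward of ρ under the translation τ_v(x) = x + v. Then F_μ(ρ̄) = F_μ(ρ) + ⟨v, b(μ)⟩ + (α/2)‖v‖² + α⟨v, b(ρ)⟩. -/

import Mathlib

open MeasureTheory ENNReal
open scoped RealInnerProductSpace

noncomputable section

/-- Euclidean space `ℝᵈ`. -/
abbrev Ed (d : ℕ) := EuclideanSpace ℝ (Fin d)

/-- The positive part of an extended real number, as an element of `ℝ≥0∞`. -/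
noncomputable def EReal.posPart (a : EReal) : ℝ≥0∞ :=
  if a = ⊤ then ⊤ else ENNReal.ofReal a.toReal

/-- Signed integral (with values in `EReal`) of a real-valued function. -/
noncomputable def sInt {α : Type*} [MeasurableSpace α] (ν : Measure α) (g : α → ℝ) : EReal :=
  ((∫⁻ x, ENNReal.ofReal (g x) ∂ν : ℝ≥0∞) : EReal) -
    ((∫⁻ x, ENNReal.ofReal (-(g x)) ∂ν : ℝ≥0∞) : EReal)

/-- Signed integral (with values in `EReal`) of an `EReal`-valued function. -/
noncomputable def eInt {α : Type*} [MeasurableSpace α] (ν : Measure α) (f : α → EReal) : EReal :=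
  ((∫⁻ x, (f x).posPart ∂ν : ℝ≥0∞) : EReal) - ((∫⁻ x, (-(f x)).posPart ∂ν : ℝ≥0∞) : EReal)

/-- The set of couplings (transport plans) between two measures on `ℝᵈ`. -/
def couplings {d : ℕ} (ρ μ : Measure (Ed d)) : Set (Measure (Ed d × Ed d)) :=
  {γ | IsProbabilityMeasure γ ∧ γ.map Prod.fst = ρ ∧ γ.map Prod.snd = μ}

/-- The maximal correlation functional `T(ρ, μ)`. -/
noncomputable def maxCorr {d : ℕ} (ρ μ : Measure (Ed d)) : EReal :=
  ⨆ γ ∈ couplings ρ μ, sInt γ (fun p => ⟪p.1, p.2⟫)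

/-- The entropy `E(ρ)` of a measure with respect to Lebesgue measure. -/
noncomputable def Ent {d : ℕ} (ρ : Measure (Ed d)) : EReal := by
  classical
  exact if _h : ρ ≪ (volume : Measure (Ed d)) then
    sInt (volume : Measure (Ed d))
      (fun x => (ρ.rnDeriv volume x).toReal * Real.log (ρ.rnDeriv volume x).toReal)
  else ⊤

/-- The second moment of a measure, with values in `ℝ≥0∞`. -/
noncomputable def M2e {d : ℕ} (ρ : Measure (Ed d)) : ℝ≥0∞ :=
  ∫⁻ x, ENNReal.ofReal (‖x‖ ^ 2) ∂ρ

/-- The regularized functional `F_μ(ρ) = E(ρ) + T(ρ, μ) + (α/2) M₂(ρ)`. -/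
noncomputable def Ffun {d : ℕ} (α : ℝ) (μ ρ : Measure (Ed d)) : EReal :=
  Ent ρ + maxCorr ρ μ + ((α / 2 : ℝ) : EReal) * ((M2e ρ : ℝ≥0∞) : EReal)

/-- The `p`-th moment `M_p(ρ) = ∫ ‖x‖^p dρ`. -/
noncomputable def Mp {d : ℕ} (p : ℝ) (ρ : Measure (Ed d)) : ℝ :=
  ∫ x, ‖x‖ ^ p ∂ρ

/-- The barycenter `b(ρ) = ∫ x dρ`. -/
noncomputable def bary {d : ℕ} (ρ : Measure (Ed d)) : Ed d :=
  ∫ x, x ∂ρ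

/-- Probability measures on `ℝᵈ` with finite first moment. -/
def P1 (d : ℕ) : Set (Measure (Ed d)) :=
  {ρ | IsProbabilityMeasure ρ ∧ Integrable (fun x => ‖x‖) ρ}

/-- Probability measures on `ℝᵈ` with finite second moment. -/
def P2 (d : ℕ) : Set (Measure (Ed d)) :=
  {ρ | IsProbabilityMeasure ρ ∧ Integrable (fun x => ‖x‖ ^ 2) ρ}

/-- `ρ` is a minimizer of `F_μ` over probability measures with finite first moment. -/
def IsMinOfF {d : ℕ} (α : ℝ) (μ ρ : Measure (Ed d)) : Prop :=
  ρ ∈ P1 d ∧ ∀ σ ∈ P1 d, Ffun α μ ρ ≤ Ffun α μ σ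

/-- The 2-Wasserstein distance between two measures on `ℝᵈ`. -/
noncomputable def W2 {d : ℕ} (ρ μ : Measure (Ed d)) : ℝ :=
  Real.sqrt ((⨅ γ ∈ couplings ρ μ, ∫⁻ p, ENNReal.ofReal (‖p.1 - p.2‖ ^ 2) ∂γ).toReal)

/-- Convexity of an `EReal`-valued function on `ℝᵈ`. -/
def EConvexOn {d : ℕ} (u : Ed d → EReal) : Prop :=
  ∀ x y : Ed d, ∀ s t : ℝ, 0 ≤ s → 0 ≤ t → s + t = 1 →
    u (s • x + t • y) ≤ (s : EReal) * u x + (t : EReal) * u y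

/-- The Legendre transform `u*(y) = sup_x (⟨x, y⟩ - u(x))` of an `EReal`-valued function. -/
noncomputable def legendre {d : ℕ} (u : Ed d → EReal) : Ed d → EReal :=
  fun y => ⨆ x : Ed d, (((⟪x, y⟫ : ℝ) : EReal) - u x)

/-- The Gaussian-regularized density `exp(-u(x) - (α/2)‖x‖²)`, with value `0` where `u = ⊤`. -/
noncomputable def gdens {d : ℕ} (α : ℝ) (u : Ed d → EReal) (x : Ed d) : ℝ≥0∞ :=
  if u x = ⊤ then 0 else ENNReal.ofReal (Real.exp (-(u x).toReal - (α / 2) * ‖x‖ ^ 2))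

/-- Adding an integrable function shifts the signed integral by its integral. -/
theorem sInt_add_integrable {α : Type*} [MeasurableSpace α] {ν : Measure α} {g h : α → ℝ}
    (hg : Measurable g) (hh : Integrable h ν) :
    sInt ν (fun x => g x + h x) = sInt ν g + ((∫ x, h x ∂ν : ℝ) : EReal) := by
  have hhm : AEMeasurable h ν := hh.1.aemeasurable
  have hP : ∫⁻ x, ENNReal.ofReal (h x) ∂ν ≠ ⊤ :=
    ((lintegral_ofReal_le_lintegral_enorm h).trans_lt hh.2).ne
  have hnm : AEMeasurable (fun x => ENNReal.ofReal (-(h x))) ν := hhm.neg.ennreal_ofReal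
  have hgm : Measurable (fun x => ENNReal.ofReal (-(g x))) := hg.neg.ennreal_ofReal
  have hN : ∫⁻ x, ENNReal.ofReal (-(h x)) ∂ν ≠ ⊤ :=
    ((lintegral_ofReal_le_lintegral_enorm (fun x => -(h x))).trans_lt hh.neg.2).ne
  have key : (∫⁻ x, ENNReal.ofReal (g x + h x) ∂ν) + (∫⁻ x, ENNReal.ofReal (-(g x)) ∂ν)
        + (∫⁻ x, ENNReal.ofReal (-(h x)) ∂ν)
      = (∫⁻ x, ENNReal.ofReal (-(g x + h x)) ∂ν) + (∫⁻ x, ENNReal.ofReal (g x) ∂ν)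
        + (∫⁻ x, ENNReal.ofReal (h x) ∂ν) := by
    rw [← lintegral_add_right _ hgm,
      ← lintegral_add_right' _ hnm, ← lintegral_add_right _ hg.ennreal_ofReal,
      ← lintegral_add_right' _ hhm.ennreal_ofReal]
    refine lintegral_congr fun x => ?_
    have aux : ∀ t : ℝ, ENNReal.ofReal t = ENNReal.ofReal (max t 0) := fun t => by simp
    rw [aux (g x + h x), aux (-(g x)), aux (-(h x)), aux (-(g x + h x)), aux (g x), aux (h x)]
    rw [← ENNReal.ofReal_add, ← ENNReal.ofReal_add, ← ENNReal.ofReal_add, ← ENNReal.ofReal_add]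
    · congr 1
      have aux2 : ∀ t : ℝ, max t 0 = t + max (-t) 0 := fun t => by grind
      rw [aux2 (g x + h x), aux2 (g x), aux2 (h x)]
      ring
    all_goals positivity
  have le1 : ∫⁻ x, ENNReal.ofReal (g x + h x) ∂ν
      ≤ (∫⁻ x, ENNReal.ofReal (g x) ∂ν) + ∫⁻ x, ENNReal.ofReal (h x) ∂ν := by
    rw [← lintegral_add_right' _ hhm.ennreal_ofReal]
    exact lintegral_mono fun x => ENNReal.ofReal_add_le
  have le2 : ∫⁻ x, ENNReal.ofReal (-(g x + h x)) ∂ν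
      ≤ (∫⁻ x, ENNReal.ofReal (-(g x)) ∂ν) + ∫⁻ x, ENNReal.ofReal (-(h x)) ∂ν := by
    rw [← lintegral_add_right' _ hnm]
    exact lintegral_mono fun x => by
      rw [neg_add]; exact ENNReal.ofReal_add_le
  have le3 : ∫⁻ x, ENNReal.ofReal (g x) ∂ν
      ≤ (∫⁻ x, ENNReal.ofReal (g x + h x) ∂ν) + ∫⁻ x, ENNReal.ofReal (-(h x)) ∂ν := by
    rw [← lintegral_add_right' _ hnm]
    refine lintegral_mono fun x => ?_
    simpa using ENNReal.ofReal_add_le (p := g x + h x) (q := -(h x))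
  have le4 : ∫⁻ x, ENNReal.ofReal (-(g x)) ∂ν
      ≤ (∫⁻ x, ENNReal.ofReal (-(g x + h x)) ∂ν) + ∫⁻ x, ENNReal.ofReal (h x) ∂ν := by
    rw [← lintegral_add_right' _ hhm.ennreal_ofReal]
    refine lintegral_mono fun x => ?_
    simpa using ENNReal.ofReal_add_le (p := -(g x + h x)) (q := h x)
  rw [integral_eq_lintegral_pos_part_sub_lintegral_neg_part hh]
  unfold sInt
  generalize ∫⁻ x, ENNReal.ofReal (g x + h x) ∂ν = A' at *
  generalize ∫⁻ x, ENNReal.ofReal (-(g x + h x)) ∂ν = B' at *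
  generalize ∫⁻ x, ENNReal.ofReal (g x) ∂ν = A at *
  generalize ∫⁻ x, ENNReal.ofReal (-(g x)) ∂ν = B at *
  generalize ∫⁻ x, ENNReal.ofReal (h x) ∂ν = P at *
  generalize ∫⁻ x, ENNReal.ofReal (-(h x)) ∂ν = N at *
  lift P to NNReal using hP
  lift N to NNReal using hN
  induction A with
  | top =>
    have hA' : A' = ⊤ := by simpa using le3
    subst hA'
    induction B with
    | top =>
      have hB' : B' = ⊤ := by simpa using le4
      subst hB'
      simp
    | coe B =>
      have hB' : B' ≠ ⊤ := ne_top_of_le_ne_top (by simp) le2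
      lift B' to NNReal using hB'
      have e : ∀ x : NNReal, (((x : ℝ≥0∞)) : EReal) = ((x : ℝ) : EReal) := fun x => rfl
      simp only [e, EReal.coe_ennreal_top, EReal.top_sub_coe, EReal.top_add_coe]
  | coe A =>
    have hA' : A' ≠ ⊤ := ne_top_of_le_ne_top (by simp) le1
    lift A' to NNReal using hA'
    induction B with
    | top =>
      have hB' : B' = ⊤ := by simpa using le4
      subst hB'
      simp [sub_eq_add_neg]
    | coe B =>
      have hB' : B' ≠ ⊤ := ne_top_of_le_ne_top (by simp) le2
      lift B' to NNReal using hB'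
      have e : ∀ x : NNReal, (((x : ℝ≥0∞)) : EReal) = ((x : ℝ) : EReal) := fun x => rfl
      have key' : (A' : ℝ) + B + N = B' + A + P := by exact_mod_cast key
      simp only [e, ENNReal.coe_toReal]
      norm_cast
      linarith

/-- Change of variables for the signed integral along a measurable embedding. -/
theorem sInt_map {α β : Type*} [MeasurableSpace α] [MeasurableSpace β] {ν : Measure α}
    {f : α → β} (hf : MeasurableEmbedding f) (g : β → ℝ) :
    sInt (ν.map f) g = sInt ν (fun x => g (f x)) := by
  simp [sInt, hf.lintegral_map]

theorem sInt_congr_ae {α : Type*} [MeasurableSpace α] {ν : Measure α} {g h : α → ℝ}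
    (hgh : g =ᵐ[ν] h) : sInt ν g = sInt ν h := by
  unfold sInt
  congr 2
  · exact lintegral_congr_ae (hgh.mono fun x hx => by simp only [hx])
  · exact lintegral_congr_ae (hgh.mono fun x hx => by simp only [hx])

/-- The entropy is invariant under translations. -/
theorem Ent_map_add_right {d : ℕ} (ρ : Measure (Ed d)) [SigmaFinite ρ] (v : Ed d) :
    Ent (ρ.map (fun x => x + v)) = Ent ρ := by
  have hf : MeasurableEmbedding (fun x : Ed d => x + v) := measurableEmbedding_addRight v
  have hvol : (volume : Measure (Ed d)).map (fun x => x + v) = volume := map_add_right_eq_self _ v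
  have hac : ρ.map (fun x => x + v) ≪ (volume : Measure (Ed d)) ↔ ρ ≪ volume := by
    conv_lhs => rw [← hvol]
    refine ⟨fun h => ?_, fun h => h.map hf.measurable⟩
    refine Measure.AbsolutelyContinuous.mk fun s _ hs => ?_
    have h' := @h (Set.image (fun x => x + v) s)
    simp only [hf.map_apply, hf.injective.preimage_image] at h'
    exact h' hs
  unfold Ent
  by_cases h : ρ ≪ (volume : Measure (Ed d))
  · rw [dif_pos h, dif_pos (hac.2 h)]
    have hrn := hf.rnDeriv_map ρ (volume : Measure (Ed d))
    rw [hvol] at hrn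
    conv_lhs => rw [← hvol]
    rw [sInt_map hf, hvol]
    exact sInt_congr_ae (hrn.mono fun x hx => by simp only [hx])
  · rw [dif_neg h, dif_neg (mt hac.1 h)]

theorem map_translate_mem_couplings {d : ℕ} {ρ μ : Measure (Ed d)}
    {γ : Measure (Ed d × Ed d)} (hγ : γ ∈ couplings ρ μ) (v : Ed d) :
    γ.map (fun p => (p.1 + v, p.2)) ∈ couplings (ρ.map (fun x => x + v)) μ := by
  obtain ⟨h, h1, h2⟩ := hγ
  refine ⟨Measure.isProbabilityMeasure_map (by fun_prop), ?_, ?_⟩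
  · rw [← h1, Measure.map_map (by fun_prop) (by fun_prop),
      Measure.map_map (by fun_prop) (by fun_prop)]
    rfl
  · rw [Measure.map_map (by fun_prop) (by fun_prop), ← h2]
    rfl

theorem measurableEmbedding_translate_fst {d : ℕ} (v : Ed d) :
    MeasurableEmbedding (fun p : Ed d × Ed d => (p.1 + v, p.2)) :=
  ((Homeomorph.addRight v).prodCongr (Homeomorph.refl (Ed d))).measurableEmbedding

theorem sInt_map_translate {d : ℕ} {ρ μ : Measure (Ed d)} (hμ : μ ∈ P1 d)
    {γ : Measure (Ed d × Ed d)} (hγ : γ ∈ couplings ρ μ) (v : Ed d) :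
    sInt (γ.map (fun p => (p.1 + v, p.2))) (fun p => ⟪p.1, p.2⟫) =
      sInt γ (fun p => ⟪p.1, p.2⟫) + ((⟪v, bary μ⟫ : ℝ) : EReal) := by
  obtain ⟨h, h1, h2⟩ := hγ
  have hid : Integrable (fun y : Ed d => y) μ :=
    (integrable_norm_iff (by fun_prop)).1 hμ.2
  have hint : Integrable (fun y : Ed d => ⟪v, y⟫) μ := hid.const_inner v
  have hI : Integrable (fun p : Ed d × Ed d => ⟪v, p.2⟫) γ := by
    rw [← h2] at hint
    exact hint.comp_measurable measurable_snd
  have hE : ∫ p : Ed d × Ed d, ⟪v, p.2⟫ ∂γ = ⟪v, bary μ⟫ := by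
    unfold bary
    rw [← integral_inner hid v]
    conv_rhs => rw [← h2]
    rw [integral_map (by fun_prop) (by fun_prop)]
  rw [sInt_map (measurableEmbedding_translate_fst v)]
  simp only [inner_add_left]
  rw [sInt_add_integrable (by fun_prop) hI, hE]

theorem le_maxCorr_map_translate {d : ℕ} (ρ : Measure (Ed d)) {μ : Measure (Ed d)}
    (hμ : μ ∈ P1 d) (v : Ed d) :
    maxCorr ρ μ + ((⟪v, bary μ⟫ : ℝ) : EReal) ≤ maxCorr (ρ.map (fun x => x + v)) μ := by
  rw [← EReal.le_sub_iff_add_le (by simp) (by simp)]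
  refine iSup₂_le fun γ hγ => ?_
  rw [EReal.le_sub_iff_add_le (by simp) (by simp), ← sInt_map_translate hμ hγ v]
  exact le_iSup₂ (f := fun γ (_ : γ ∈ couplings (ρ.map (fun x => x + v)) μ) =>
    sInt γ (fun p => ⟪p.1, p.2⟫)) _ (map_translate_mem_couplings hγ v)

theorem maxCorr_map_add_right {d : ℕ} (ρ : Measure (Ed d)) {μ : Measure (Ed d)}
    (hμ : μ ∈ P1 d) (v : Ed d) :
    maxCorr (ρ.map (fun x => x + v)) μ = maxCorr ρ μ + ((⟪v, bary μ⟫ : ℝ) : EReal) := by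
  refine le_antisymm ?_ (le_maxCorr_map_translate ρ hμ v)
  have h := le_maxCorr_map_translate (ρ.map (fun x => x + v)) hμ (-v)
  have hρ : (ρ.map (fun x => x + v)).map (fun x => x + -v) = ρ := by
    rw [Measure.map_map (by fun_prop) (by fun_prop)]
    convert Measure.map_id
    ext x
    simp
  rw [hρ, inner_neg_left, EReal.coe_neg, ← sub_eq_add_neg] at h
  exact (EReal.sub_le_iff_le_add (by simp) (by simp)).1 h

theorem M2e_map_add_right {d : ℕ} {ρ : Measure (Ed d)} (hρ : ρ ∈ P1 d) (v : Ed d) :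
    ((M2e (ρ.map (fun x => x + v)) : ℝ≥0∞) : EReal) =
      ((M2e ρ : ℝ≥0∞) : EReal) + ((2 * ⟪v, bary ρ⟫ + ‖v‖ ^ 2 : ℝ) : EReal) := by
  have hs : ∀ σ : Measure (Ed d), ((M2e σ : ℝ≥0∞) : EReal) = sInt σ (fun x => ‖x‖ ^ 2) := by
    intro σ
    have h0 : ∀ x : Ed d, ENNReal.ofReal (-(‖x‖ ^ 2)) = 0 := fun x =>
      ENNReal.ofReal_of_nonpos (neg_nonpos.2 (by positivity))
    simp only [sInt, M2e, h0, lintegral_zero, EReal.coe_ennreal_zero, sub_zero]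
  have := hρ.1
  have hid : Integrable (fun y : Ed d => y) ρ :=
    (integrable_norm_iff (by fun_prop)).1 hρ.2
  have hint : Integrable (fun y : Ed d => 2 * ⟪v, y⟫) ρ := (hid.const_inner v).const_mul 2
  have hE : ∫ x : Ed d, (2 * ⟪v, x⟫ + ‖v‖ ^ 2) ∂ρ = 2 * ⟪v, bary ρ⟫ + ‖v‖ ^ 2 := by
    rw [integral_add hint (integrable_const _), integral_const_mul, integral_inner hid v]
    simp [bary]
  have hint' : Integrable (fun y : Ed d => 2 * ⟪v, y⟫ + ‖v‖ ^ 2) ρ :=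
    hint.add (integrable_const _)
  rw [hs, hs, sInt_map (measurableEmbedding_addRight v), ← hE,
    ← sInt_add_integrable (by fun_prop) hint']
  congr 1
  ext x
  rw [norm_add_sq_real, real_inner_comm]
  ring

/-- effect of translating `ρ` on `F_μ`. -/
theorem stmt1 (d : ℕ) (hd : 1 ≤ d) (α : ℝ) (hα : 0 < α)
    (μ ρ : Measure (Ed d)) (hμ : μ ∈ P1 d) (hρ : ρ ∈ P1 d) (v : Ed d) :
    Ffun α μ (ρ.map (fun x => x + v)) =
      Ffun α μ ρ +
        ((⟪v, bary μ⟫ + (α / 2) * ‖v‖ ^ 2 + α * ⟪v, bary ρ⟫ : ℝ) : EReal) := by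
  have := hρ.1
  have hsplit : ⟪v, bary μ⟫ + (α / 2) * ‖v‖ ^ 2 + α * ⟪v, bary ρ⟫
      = ⟪v, bary μ⟫ + (α / 2) * (2 * ⟪v, bary ρ⟫ + ‖v‖ ^ 2) := by ring
  unfold Ffun
  rw [Ent_map_add_right, maxCorr_map_add_right ρ hμ v, M2e_map_add_right hρ v,
    EReal.left_distrib_of_nonneg_of_ne_top (by exact_mod_cast (half_pos hα).le) (by simp),
    hsplit, EReal.coe_add ⟪v, bary μ⟫, EReal.coe_mul (α / 2)]
  abel
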